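/- Let Ω be a differential 2-form of type 4 on a smooth 4-dimensional manifold M such that (Z_Ω, T_Ω, U_Ω, V_Ω) is a linear frame (so J(Ω) vanishes nowhere). Define T'_Ω = T_Ω − (Z_Ω(J(Ω))/J(Ω))·Z_Ω, U'_Ω = (1/J(Ω))·U_Ω − (Ω(U_Ω,V_Ω)/J(Ω)²)·Z_Ω, V'_Ω = (1/J(Ω))·V_Ω. Then the frame (Z_Ω, T'_Ω, U'_Ω, V'_Ω) is symplectic for Ω: Ω(Z_Ω,T'_Ω) = 0, Ω(Z_Ω,U'_Ω) = 0, Ω(Z_Ω,V'_Ω) = 1, Ω(T'_Ω,U'_Ω) = 1, Ω(T'_Ω,V'_Ω) = 0, Ω(U'_Ω,V'_Ω) = 0. -/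

import Mathlib

/-!  Coordinate formalization of differential forms in four variables,
     following "The equivalence problem of differential 2-forms in 4 variables". -/

open Real Filter

/-- Points of `ℝ⁴`; the coordinates `x¹, x², x³, x⁴` of the paper are `x 0, x 1, x 2, x 3`. -/
abbrev Pt := Fin 4 → ℝ

/-- Partial derivative `∂f/∂xⁱ`. -/
noncomputable def pd (i : Fin 4) (f : Pt → ℝ) (x : Pt) : ℝ :=
  fderiv ℝ f x (Pi.single i 1)

/-- Second partial derivative `∂²f/∂xⁱ∂xʲ`. -/
noncomputable def pd2 (i j : Fin 4) (f : Pt → ℝ) (x : Pt) : ℝ :=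
  pd i (fun y => pd j f y) x

/-- Differential forms of degree 0,1,2,3,4 on `ℝ⁴`, given by their (skew-symmetric)
    coordinate components, and vector fields. -/
abbrev Form0 := Pt → ℝ
abbrev Form1 := Pt → Fin 4 → ℝ
abbrev Form2 := Pt → Fin 4 → Fin 4 → ℝ
abbrev Form3 := Pt → Fin 4 → Fin 4 → Fin 4 → ℝ
abbrev Form4 := Pt → Fin 4 → Fin 4 → Fin 4 → Fin 4 → ℝ
abbrev Vec := Pt → Fin 4 → ℝ

/-- A 2-form has skew-symmetric components. -/
def Alt2 (B : Form2) : Prop := ∀ x i j, B x i j = - B x j i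

/-- Exterior derivative of a function. -/
noncomputable def d0 (f : Form0) : Form1 := fun x i => pd i f x

/-- Exterior derivative of a 1-form. -/
noncomputable def d1 (ω : Form1) : Form2 := fun x i j =>
  pd i (fun y => ω y j) x - pd j (fun y => ω y i) x

/-- Exterior derivative of a 2-form. -/
noncomputable def d2 (B : Form2) : Form3 := fun x i j k =>
  pd i (fun y => B y j k) x - pd j (fun y => B y i k) x + pd k (fun y => B y i j) x

/-- Wedge product of two 1-forms. -/
def w11 (ω η : Form1) : Form2 := fun x i j => ω x i * η x j - ω x j * η x i

/-- Wedge product of a 1-form and a 2-form. -/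
def w12 (ω : Form1) (B : Form2) : Form3 := fun x i j k =>
  ω x i * B x j k - ω x j * B x i k + ω x k * B x i j

/-- Wedge product of a 1-form and a 3-form. -/
def w13 (ω : Form1) (C : Form3) : Form4 := fun x i j k l =>
  ω x i * C x j k l - ω x j * C x i k l + ω x k * C x i j l - ω x l * C x i j k

/-- Wedge product of two 2-forms. -/
def w22 (A B : Form2) : Form4 := fun x i j k l =>
  A x i j * B x k l - A x i k * B x j l + A x i l * B x j k
    + A x j k * B x i l - A x j l * B x i k + A x k l * B x i j

/-- A 2-form is of rank 4 when `Ω ∧ Ω` vanishes nowhere. -/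
def Rank4 (B : Form2) : Prop := ∀ x, w22 B B x ≠ 0

/-- Interior products `i_X`. -/
def i1 (X : Vec) (ω : Form1) : Form0 := fun x => ∑ i, X x i * ω x i
def i2 (X : Vec) (B : Form2) : Form1 := fun x j => ∑ i, X x i * B x i j
def i3 (X : Vec) (C : Form3) : Form2 := fun x j k => ∑ i, X x i * C x i j k
def i4 (X : Vec) (D : Form4) : Form3 := fun x j k l => ∑ i, X x i * D x i j k l

/-- Evaluation `B(X,Y)` of a 2-form on two vector fields. -/
def ev2 (B : Form2) (X Y : Vec) : Form0 := fun x => ∑ i, ∑ j, X x i * Y x j * B x i j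

/-- Evaluation `D(X,Y,Z,W)` of a 4-form on four vector fields. -/
def ev4 (D : Form4) (X Y Z W : Vec) : Form0 := fun x =>
  ∑ i, ∑ j, ∑ k, ∑ l, X x i * Y x j * Z x k * W x l * D x i j k l

/-- Lie derivative of a 1-form (Cartan's magic formula). -/
noncomputable def lie1 (X : Vec) (ω : Form1) : Form1 := fun x i =>
  d0 (i1 X ω) x i + i2 X (d1 ω) x i

/-- Lie derivative of a 2-form (Cartan's magic formula). -/
noncomputable def lie2 (X : Vec) (B : Form2) : Form2 := fun x i j =>
  d1 (i2 X B) x i j + i3 X (d2 B) x i j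

/-- Lie bracket of two vector fields. -/
noncomputable def bracket (X Y : Vec) : Vec := fun x i =>
  ∑ j, (X x j * pd j (fun y => Y y i) x - Y x j * pd j (fun y => X y i) x)

/-- Derivative `X(f)` of a function along a vector field. -/
noncomputable def dirDeriv (X : Vec) (f : Form0) : Form0 := fun x => ∑ j, X x j * pd j f x

/-- Pullback of a 1-form under a smooth map. -/
noncomputable def pull1 (φ : Pt → Pt) (ω : Form1) : Form1 := fun x i =>
  ∑ a, ω (φ x) a * pd i (fun y => φ y a) x

/-- Pullback of a 2-form under a smooth map. -/
noncomputable def pull2 (φ : Pt → Pt) (B : Form2) : Form2 := fun x i j =>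
  ∑ a, ∑ b, B (φ x) a b * pd i (fun y => φ y a) x * pd j (fun y => φ y b) x

/-- A pair of mutually inverse smooth maps: a diffeomorphism of `ℝ⁴` (with inverse). -/
def IsDiffeo (φ ψ : Pt → Pt) : Prop :=
  ContDiff ℝ (⊤ : ℕ∞) φ ∧ ContDiff ℝ (⊤ : ℕ∞) ψ ∧ (∀ x, ψ (φ x) = x) ∧ (∀ x, φ (ψ x) = x)

/-- The covector with components `c` as a linear functional on the tangent space `ℝ⁴`. -/
noncomputable def covec (c : Fin 4 → ℝ) : Pt →ₗ[ℝ] ℝ :=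
  ∑ i, c i • (LinearMap.proj i : Pt →ₗ[ℝ] ℝ)

/-- The class of a 1-form `ω` at `x`: the codimension of the space of tangent vectors `v`
    with `i_v ω = 0` and `i_v (dω) = 0`. -/
noncomputable def classAt (ω : Form1) (x : Pt) : ℕ :=
  4 - Module.finrank ℝ
    ↥(LinearMap.ker (covec (ω x)) ⊓ ⨅ j, LinearMap.ker (covec (fun i => d1 ω x i j)))

/-- Components of the constant 2-form `dxᵃ ∧ dxᵇ`. -/
def dxw (a b : Fin 4) : Fin 4 → Fin 4 → ℝ := fun i j =>
  (if i = a ∧ j = b then (1:ℝ) else 0) - (if i = b ∧ j = a then (1:ℝ) else 0)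

/-- A germ of 2-form (with associated 1-form `ω = ω_Ω`) is of type `t` at `x₀`:
    `ω` is nonsingular at `x₀` and of constant class `t` near `x₀`. -/
def IsTypeAt (ω : Form1) (t : ℕ) (x₀ : Pt) : Prop :=
  ω x₀ ≠ 0 ∧ ∀ᶠ x in nhds x₀, classAt ω x = t

lemma pd_mul (i : Fin 4) {f g : Pt → ℝ} {x : Pt} (hf : DifferentiableAt ℝ f x)
    (hg : DifferentiableAt ℝ g x) :
    pd i (fun y => f y * g y) x = f x * pd i g x + g x * pd i f x := by
  unfold pd
  rw [fderiv_fun_mul hf hg]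
  simp

lemma pd_add (i : Fin 4) {f g : Pt → ℝ} {x : Pt} (hf : DifferentiableAt ℝ f x)
    (hg : DifferentiableAt ℝ g x) :
    pd i (fun y => f y + g y) x = pd i f x + pd i g x := by
  unfold pd
  rw [fderiv_fun_add hf hg]
  simp

lemma pd_sub (i : Fin 4) {f g : Pt → ℝ} {x : Pt} (hf : DifferentiableAt ℝ f x)
    (hg : DifferentiableAt ℝ g x) :
    pd i (fun y => f y - g y) x = pd i f x - pd i g x := by
  unfold pd
  rw [fderiv_fun_sub hf hg]
  simp

lemma pd_sum (i : Fin 4) {f : Fin 4 → Pt → ℝ} {x : Pt}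
    (hf : ∀ a, DifferentiableAt ℝ (f a) x) :
    pd i (fun y => ∑ a, f a y) x = ∑ a, pd i (f a) x := by
  unfold pd
  rw [fderiv_fun_sum (fun a _ => hf a)]
  simp

lemma pd_contDiff (i : Fin 4) {f : Pt → ℝ} (hf : ContDiff ℝ (⊤ : ℕ∞) f) :
    ContDiff ℝ (⊤ : ℕ∞) (fun y => pd i f y) := by
  unfold pd
  exact (hf.fderiv_right (m := (⊤ : ℕ∞)) (by simp)).clm_apply contDiff_const

lemma pd_comm (i j : Fin 4) {f : Pt → ℝ} (hf : ContDiff ℝ (⊤ : ℕ∞) f) (x : Pt) :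
    pd i (fun y => pd j f y) x = pd j (fun y => pd i f y) x := by
  have hd : DifferentiableAt ℝ (fderiv ℝ f) x :=
    ((hf.fderiv_right (m := (⊤ : ℕ∞)) (by simp)).differentiable (by simp)) x
  have hs : IsSymmSndFDerivAt ℝ f x :=
    (hf.contDiffAt).isSymmSndFDerivAt (by
      simp only [minSmoothness_of_isRCLikeNormedField]
      exact WithTop.coe_le_coe.2 (le_top (a := (2 : ℕ∞))))
  unfold pd
  rw [fderiv_clm_apply hd (by fun_prop), fderiv_clm_apply hd (by fun_prop)]
  simpa using hs.eq _ _

lemma bracket_contDiff {X Y : Vec} (hX : ∀ i, ContDiff ℝ (⊤ : ℕ∞) fun y => X y i)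
    (hY : ∀ i, ContDiff ℝ (⊤ : ℕ∞) fun y => Y y i) (i : Fin 4) :
    ContDiff ℝ (⊤ : ℕ∞) fun y => bracket X Y y i := by
  unfold bracket
  exact ContDiff.sum fun j _ =>
    ((hX j).mul (pd_contDiff j (hY i))).sub ((hY j).mul (pd_contDiff j (hX i)))

/-- Cartan formula for a 1-form. -/
lemma cartan1 {X Y : Vec} {α : Form1} (hX : ∀ i, Differentiable ℝ fun y => X y i)
    (hY : ∀ i, Differentiable ℝ fun y => Y y i) (hα : ∀ i, Differentiable ℝ fun y => α y i)
    (x : Pt) :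
    dirDeriv X (i1 Y α) x - dirDeriv Y (i1 X α) x - i1 (bracket X Y) α x
      = ev2 (d1 α) X Y x := by
  have h : ∀ (W : Vec), (∀ i, Differentiable ℝ fun y => W y i) → ∀ j, pd j (i1 W α) x
      = ∑ a, (W x a * pd j (fun y => α y a) x + α x a * pd j (fun y => W y a) x) := by
    intro W hW j
    unfold i1
    rw [pd_sum j (fun a => ((hW a) x).fun_mul ((hα a) x))]
    exact Finset.sum_congr rfl fun a _ => pd_mul j ((hW a) x) ((hα a) x)
  unfold dirDeriv
  simp only [h X hX, h Y hY]
  unfold i1 ev2 bracket d1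
  generalize hA : (fun i j => pd i (fun y => α y j) x) = A
  generalize hB : (fun i j => pd i (fun y => X y j) x) = B
  generalize hC : (fun i j => pd i (fun y => Y y j) x) = C
  have hA' : ∀ i j, pd i (fun y => α y j) x = A i j := fun i j => by rw [← hA]
  have hB' : ∀ i j, pd i (fun y => X y j) x = B i j := fun i j => by rw [← hB]
  have hC' : ∀ i j, pd i (fun y => Y y j) x = C i j := fun i j => by rw [← hC]
  simp only [hA', hB', hC', Fin.sum_univ_four]
  ring

/-- Lie derivative of a 2-form in coordinates. -/
lemma lie2_eq {Z : Vec} {B : Form2} (hBa : Alt2 B) (hZ : ∀ i, Differentiable ℝ fun y => Z y i)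
    (hB : ∀ i j, Differentiable ℝ fun y => B y i j) (x : Pt) (i j : Fin 4) :
    lie2 Z B x i j = ∑ a, (pd i (fun y => Z y a) x * B x a j + pd j (fun y => Z y a) x * B x i a
      + Z x a * pd a (fun y => B y i j) x) := by
  have h : ∀ k l, pd k (fun y => i2 Z B y l) x
      = ∑ a, (Z x a * pd k (fun y => B y a l) x + B x a l * pd k (fun y => Z y a) x) := by
    intro k l
    unfold i2
    rw [pd_sum k (fun a => ((hZ a) x).fun_mul ((hB a l) x))]
    exact Finset.sum_congr rfl fun a _ => pd_mul k ((hZ a) x) ((hB a l) x)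
  unfold lie2 d1 i3 d2
  rw [h, h, ← Finset.sum_sub_distrib, ← Finset.sum_add_distrib]
  exact Finset.sum_congr rfl fun a _ => by rw [hBa x i a]; ring

set_option maxRecDepth 4000 in
lemma lie2_ev {Z X Y : Vec} {B : Form2} (hBa : Alt2 B)
    (hZ : ∀ i, Differentiable ℝ fun y => Z y i)
    (hX : ∀ i, Differentiable ℝ fun y => X y i) (hY : ∀ i, Differentiable ℝ fun y => Y y i)
    (hB : ∀ i j, Differentiable ℝ fun y => B y i j) (x : Pt) :
    dirDeriv Z (ev2 B X Y) x = ev2 B (bracket Z X) Y x + ev2 B X (bracket Z Y) x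
      + ev2 (lie2 Z B) X Y x := by
  have h : ∀ k, pd k (ev2 B X Y) x = ∑ i, ∑ j, (X x i * Y x j * pd k (fun y => B y i j) x
      + B x i j * (X x i * pd k (fun y => Y y j) x + Y x j * pd k (fun y => X y i) x)) := by
    intro k
    unfold ev2
    rw [pd_sum k (fun i => by
      have := hX i; have := hY; have := hB i; fun_prop)]
    refine Finset.sum_congr rfl fun i _ => ?_
    rw [pd_sum k (fun j => (((hX i) x).fun_mul ((hY j) x)).fun_mul ((hB i j) x))]
    refine Finset.sum_congr rfl fun j _ => ?_
    rw [pd_mul k (((hX i) x).fun_mul ((hY j) x)) ((hB i j) x), pd_mul k ((hX i) x) ((hY j) x)]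
  unfold dirDeriv
  simp only [h]
  unfold ev2 bracket
  simp only [lie2_eq hBa hZ hB]
  generalize hA : (fun a i j => pd a (fun y => B y i j) x) = A
  generalize hC : (fun i j => pd i (fun y => X y j) x) = C
  generalize hD : (fun i j => pd i (fun y => Y y j) x) = D
  generalize hE : (fun i j => pd i (fun y => Z y j) x) = E
  have hA' : ∀ a i j, pd a (fun y => B y i j) x = A a i j := fun a i j => by rw [← hA]
  have hC' : ∀ i j, pd i (fun y => X y j) x = C i j := fun i j => by rw [← hC]
  have hD' : ∀ i j, pd i (fun y => Y y j) x = D i j := fun i j => by rw [← hD]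
  have hE' : ∀ i j, pd i (fun y => Z y j) x = E i j := fun i j => by rw [← hE]
  simp only [hA', hC', hD', hE']
  simp only [Fin.sum_univ_four]
  ring

lemma con3 (α : Form1) (B : Form2) (X Y W : Vec) (x : Pt) :
    ∑ i, ∑ j, ∑ k, X x i * Y x j * W x k * w12 α B x i j k
      = i1 X α x * ev2 B Y W x - i1 Y α x * ev2 B X W x + i1 W α x * ev2 B X Y x := by
  unfold w12 i1 ev2
  simp only [Fin.sum_univ_four]
  ring

/-- `dω ∧ Ω = 0` when `dΩ = ω ∧ Ω`. -/
lemma dclosed {Ω : Form2} {ω : Form1} (hΩ : ∀ i j, ContDiff ℝ (⊤ : ℕ∞) fun y => Ω y i j)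
    (hω : ∀ i, ContDiff ℝ (⊤ : ℕ∞) fun y => ω y i)
    (h : ∀ x, w12 ω Ω x = d2 Ω x) (x : Pt) (i j k l : Fin 4) :
    w22 (d1 ω) Ω x i j k l = 0 := by
  have dΩ : ∀ i j, DifferentiableAt ℝ (fun y => Ω y i j) x :=
    fun i j => (hΩ i j).differentiable (by simp) x
  have dω : ∀ i, DifferentiableAt ℝ (fun y => ω y i) x :=
    fun i => (hω i).differentiable (by simp) x
  have dp : ∀ a i j, DifferentiableAt ℝ (fun z => pd a (fun y => Ω y i j) z) x :=
    fun a i j => (pd_contDiff a (hΩ i j)).differentiable (by simp) x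
  have e : ∀ m a b c, pd m (fun y => w12 ω Ω y a b c) x = pd m (fun y => d2 Ω y a b c) x := by
    intro m a b c
    simp only [h]
  have e1 : ∀ m a b c, pd m (fun y => d2 Ω y a b c) x
      = pd m (fun z => pd a (fun y => Ω y b c) z) x - pd m (fun z => pd b (fun y => Ω y a c) z) x
        + pd m (fun z => pd c (fun y => Ω y a b) z) x := by
    intro m a b c
    unfold d2
    rw [pd_add m ((dp _ _ _).fun_sub (dp _ _ _)) (dp _ _ _), pd_sub m (dp _ _ _) (dp _ _ _)]
  have e2 : ∀ m a b c, pd m (fun y => w12 ω Ω y a b c) x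
      = (ω x a * pd m (fun y => Ω y b c) x + Ω x b c * pd m (fun y => ω y a) x)
        - (ω x b * pd m (fun y => Ω y a c) x + Ω x a c * pd m (fun y => ω y b) x)
        + (ω x c * pd m (fun y => Ω y a b) x + Ω x a b * pd m (fun y => ω y c) x) := by
    intro m a b c
    unfold w12
    rw [pd_add m (((dω _).fun_mul (dΩ _ _)).fun_sub ((dω _).fun_mul (dΩ _ _))) ((dω _).fun_mul (dΩ _ _)),
      pd_sub m ((dω _).fun_mul (dΩ _ _)) ((dω _).fun_mul (dΩ _ _)), pd_mul m (dω _) (dΩ _ _),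
      pd_mul m (dω _) (dΩ _ _), pd_mul m (dω _) (dΩ _ _)]
  simp only [e1, e2] at e
  have s : ∀ a b c d, pd a (fun z => pd b (fun y => Ω y c d) z) x
      = pd b (fun z => pd a (fun y => Ω y c d) z) x := fun a b c d => pd_comm a b (hΩ c d) x
  have f : ∀ a b c, ω x a * Ω x b c - ω x b * Ω x a c + ω x c * Ω x a b
      = pd a (fun y => Ω y b c) x - pd b (fun y => Ω y a c) x + pd c (fun y => Ω y a b) x :=
    fun a b c => congrFun (congrFun (congrFun (h x) a) b) c
  unfold w22 d1
  linear_combination e i j k l - e j i k l + e k i j l - e l i j k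
    + s i j k l - s i k j l + s i l j k + s j k i l - s j l i k + s k l i j
    - ω x i * f j k l + ω x j * f i k l - ω x k * f i j l + ω x l * f i j k

/-- Injectivity of `α ↦ α ∧ Ω`. -/
lemma wedge_inj {Ω : Form2} (hΩa : Alt2 Ω) (hΩr : Rank4 Ω) (α : Fin 4 → ℝ) (x : Pt)
    (h : ∀ i j k, α i * Ω x j k - α j * Ω x i k + α k * Ω x i j = 0) (m : Fin 4) : α m = 0 := by
  have a := hΩa x
  have key : ∀ i j k l, α i * w22 Ω Ω x i j k l = 0 := by
    intro m a b c
    unfold w22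
    linear_combination 2 * (Ω x m a * h m b c - Ω x m b * h m a c + Ω x m c * h m a b)
  have sw1 : ∀ i j k l, w22 Ω Ω x i j k l = - w22 Ω Ω x j i k l := by
    intro i j k l
    unfold w22
    rw [a j i]
    ring
  have sw2 : ∀ i j k l, w22 Ω Ω x i j k l = - w22 Ω Ω x i k j l := by
    intro i j k l
    unfold w22
    rw [a k j]
    ring
  have sw3 : ∀ i j k l, w22 Ω Ω x i j k l = - w22 Ω Ω x i j l k := by
    intro i j k l
    unfold w22
    rw [a l k]
    ring
  by_contra hm
  have z0 : ∀ j k l, w22 Ω Ω x m j k l = 0 := fun j k l =>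
    (mul_eq_zero.1 (key m j k l)).resolve_left hm
  have z1 : ∀ j k l, w22 Ω Ω x j m k l = 0 := fun j k l => by rw [sw1, z0, neg_zero]
  have z2 : ∀ j k l, w22 Ω Ω x j k m l = 0 := fun j k l => by rw [sw2, z1, neg_zero]
  have z3 : ∀ j k l, w22 Ω Ω x j k l m = 0 := fun j k l => by rw [sw3, z2, neg_zero]
  apply hΩr x
  funext i j k l
  change w22 Ω Ω x i j k l = 0
  by_cases hi : m = i
  · subst hi; exact z0 _ _ _
  by_cases hj : m = j
  · subst hj; exact z1 _ _ _
  by_cases hk : m = k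
  · subst hk; exact z2 _ _ _
  by_cases hl : m = l
  · subst hl; exact z3 _ _ _
  have t1 : ∀ i k l, w22 Ω Ω x i i k l = 0 := fun i k l => by linarith [sw1 i i k l]
  have t2 : ∀ i k l, w22 Ω Ω x i k k l = 0 := fun i k l => by linarith [sw2 i k k l]
  have t3 : ∀ i k l, w22 Ω Ω x i k l l = 0 := fun i k l => by linarith [sw3 i k l l]
  have t4 : ∀ i k l, w22 Ω Ω x i k i l = 0 := fun i k l => by rw [sw2, t1, neg_zero]
  have t5 : ∀ i k l, w22 Ω Ω x i k l k = 0 := fun i k l => by rw [sw3, t2, neg_zero]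
  have t6 : ∀ i k l, w22 Ω Ω x i k l i = 0 := fun i k l => by rw [sw3, t4, neg_zero]
  have hp : i = j ∨ j = k ∨ k = l ∨ i = k ∨ j = l ∨ i = l := by omega
  rcases hp with rfl | rfl | rfl | rfl | rfl | rfl
  · exact t1 _ _ _
  · exact t2 _ _ _
  · exact t3 _ _ _
  · exact t4 _ _ _
  · exact t5 _ _ _
  · exact t6 _ _ _

lemma ev2_i2 (B : Form2) (X Y : Vec) (x : Pt) : ev2 B X Y x = i1 Y (i2 X B) x := by
  unfold ev2 i1 i2
  rw [Finset.sum_comm]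
  refine Finset.sum_congr rfl fun j _ => ?_
  rw [Finset.mul_sum]
  exact Finset.sum_congr rfl fun i _ => by ring

lemma ev2_skew {B : Form2} (hB : Alt2 B) (X Y : Vec) (x : Pt) :
    ev2 B X Y x = - ev2 B Y X x := by
  unfold ev2
  rw [Finset.sum_comm, ← Finset.sum_neg_distrib]
  refine Finset.sum_congr rfl fun j _ => ?_
  rw [← Finset.sum_neg_distrib]
  exact Finset.sum_congr rfl fun i _ => by rw [hB x i j]; ring

/-- Bilinearity, in the form needed. -/
lemma ev2_lin (B : Form2) (X Y A C E F : Vec) (x : Pt) (p q r s : ℝ)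
    (hX : ∀ i, X x i = p * A x i - q * C x i) (hY : ∀ i, Y x i = r * E x i - s * F x i) :
    ev2 B X Y x = p * r * ev2 B A E x - p * s * ev2 B A F x - q * r * ev2 B C E x
      + q * s * ev2 B C F x := by
  unfold ev2
  simp only [hX, hY, Finset.mul_sum, ← Finset.sum_sub_distrib, ← Finset.sum_add_distrib]
  exact Finset.sum_congr rfl fun i _ => Finset.sum_congr rfl fun j _ => by ring

/-- from Theorem `TheBasis`. The normalized frame
`(Z_Ω, T'_Ω, U'_Ω, V'_Ω)` is symplectic for `Ω`. -/
theorem normalized_frame_symplectic (Ω : Form2) (hΩs : ContDiff ℝ (⊤ : ℕ∞) Ω)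
    (hΩa : Alt2 Ω) (hΩr : Rank4 Ω)
    (ω : Form1) (hωs : ContDiff ℝ (⊤ : ℕ∞) ω) (hω : ∀ x, w12 ω Ω x = d2 Ω x)
    (θ : Form1) (hθs : ContDiff ℝ (⊤ : ℕ∞) θ) (hθ : ∀ x, w12 θ Ω x = w12 ω (d1 ω) x)
    (Z : Vec) (hZs : ContDiff ℝ (⊤ : ℕ∞) Z) (hZ : ∀ x, i2 Z Ω x = ω x)
    (T : Vec) (hTs : ContDiff ℝ (⊤ : ℕ∞) T) (hT : ∀ x, i2 T Ω x = θ x)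
    (htype4 : ∀ x, ω x ≠ 0 ∧ classAt ω x = 4)
    (Uv Vv : Vec) (hU : Uv = bracket Z T) (hV : Vv = bracket Z Uv)
    (J : Form0) (hJ : ∀ x, J x = i1 Uv θ x)
    (hframe : ∀ x, LinearIndependent ℝ ![Z x, T x, Uv x, Vv x])
    (hJne : ∀ x, J x ≠ 0)
    (T' U' V' : Vec)
    (hT' : ∀ x i, T' x i = T x i - (dirDeriv Z J x / J x) * Z x i)
    (hU' : ∀ x i, U' x i = (1 / J x) * Uv x i - (ev2 Ω Uv Vv x / (J x) ^ 2) * Z x i)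
    (hV' : ∀ x i, V' x i = (1 / J x) * Vv x i) :
    (∀ x, ev2 Ω Z T' x = 0) ∧ (∀ x, ev2 Ω Z U' x = 0) ∧ (∀ x, ev2 Ω Z V' x = 1) ∧
    (∀ x, ev2 Ω T' U' x = 1) ∧ (∀ x, ev2 Ω T' V' x = 0) ∧ (∀ x, ev2 Ω U' V' x = 0) := by
  have cΩ : ∀ i j, ContDiff ℝ (⊤ : ℕ∞) fun y => Ω y i j := fun i j =>
    contDiff_pi.1 (contDiff_pi.1 hΩs i) j
  have cω : ∀ i, ContDiff ℝ (⊤ : ℕ∞) fun y => ω y i := contDiff_pi.1 hωs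
  have cZ : ∀ i, ContDiff ℝ (⊤ : ℕ∞) fun y => Z y i := contDiff_pi.1 hZs
  have cT : ∀ i, ContDiff ℝ (⊤ : ℕ∞) fun y => T y i := contDiff_pi.1 hTs
  have cU : ∀ i, ContDiff ℝ (⊤ : ℕ∞) fun y => Uv y i := by
    rw [hU]; exact bracket_contDiff cZ cT
  have dΩ : ∀ i j, Differentiable ℝ fun y => Ω y i j :=
    fun i j => (cΩ i j).differentiable (by simp)
  have dω : ∀ i, Differentiable ℝ fun y => ω y i := fun i => (cω i).differentiable (by simp)
  have dZ : ∀ i, Differentiable ℝ fun y => Z y i := fun i => (cZ i).differentiable (by simp)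
  have dT : ∀ i, Differentiable ℝ fun y => T y i := fun i => (cT i).differentiable (by simp)
  have dU : ∀ i, Differentiable ℝ fun y => Uv y i := fun i => (cU i).differentiable (by simp)
  have iZ : i2 Z Ω = ω := funext hZ
  have iT : i2 T Ω = θ := funext hT
  have hself : ∀ X x, ev2 Ω X X x = 0 := fun X x => by linarith [ev2_skew hΩa X X x]
  have evZ : ∀ X x, ev2 Ω Z X x = i1 X ω x := fun X x => by rw [ev2_i2, iZ]
  have evT : ∀ X x, ev2 Ω T X x = i1 X θ x := fun X x => by rw [ev2_i2, iT]
  have ωZ : ∀ x, i1 Z ω x = 0 := fun x => by rw [← evZ, hself]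
  have θT : ∀ x, i1 T θ x = 0 := fun x => by rw [← evT, hself]
  -- θ = - i_Z dω
  have hθZ : ∀ x m, i2 Z (d1 ω) x m = - θ x m := by
    intro x m
    have hw := wedge_inj hΩa hΩr (fun m => θ x m + i2 Z (d1 ω) x m) x (by
      intro j k l
      have e1 : θ x j * Ω x k l - θ x k * Ω x j l + θ x l * Ω x j k
          = ω x j * d1 ω x k l - ω x k * d1 ω x j l + ω x l * d1 ω x j k :=
        congrFun (congrFun (congrFun (hθ x) j) k) l
      have e2 : ∑ i, Z x i * w22 (d1 ω) Ω x i j k l = 0 :=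
        Finset.sum_eq_zero fun i _ => by rw [dclosed cΩ cω hω x i j k l, mul_zero]
      have e3 : ∀ a, ω x a = ∑ i, Z x i * Ω x i a := fun a => (congrFun (hZ x) a).symm
      rw [e3 j, e3 k, e3 l] at e1
      unfold i2
      unfold w22 at e2
      simp only [Fin.sum_univ_four] at e1 e2 ⊢
      linear_combination e1 + e2) m
    linarith
  have dωZ : ∀ X x, ev2 (d1 ω) Z X x = - i1 X θ x := by
    intro X x
    rw [ev2_i2]
    unfold i1
    rw [← Finset.sum_neg_distrib]
    exact Finset.sum_congr rfl fun i _ => by rw [hθZ]; ring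
  have dωalt : Alt2 (d1 ω) := fun x i j => by unfold d1; ring
  have θZ : ∀ x, i1 Z θ x = 0 := by
    intro x
    linarith [dωZ Z x, ev2_skew dωalt Z Z x]
  have ωT : ∀ x, i1 T ω x = 0 := by
    intro x
    rw [← evZ, ev2_skew hΩa, evT, θZ, neg_zero]
  have fz : ∀ (X : Vec) (f : Form0), (∀ x, f x = 0) → ∀ x, dirDeriv X f x = 0 := by
    intro X f hf x
    have : f = fun _ => 0 := funext hf
    subst this
    simp [dirDeriv, pd]
  have ωU : ∀ x, i1 Uv ω x = 0 := by
    intro x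
    have := cartan1 dZ dT dω x
    rw [fz Z _ ωT, fz T _ ωZ, dωZ, θT, ← hU] at this
    linarith
  have ωV : ∀ x, i1 Vv ω x = J x := by
    intro x
    have := cartan1 dZ dU dω x
    rw [fz Z _ ωU, fz Uv _ ωZ, dωZ, ← hJ, ← hV] at this
    linarith
  have dωTU : ∀ x, ev2 (d1 ω) T Uv x = 0 := by
    intro x
    have h1 := con3 θ Ω T Uv Vv x
    rw [hθ x, con3 ω (d1 ω) T Uv Vv x, ωT, ωU, ωV, θT, evT, evT, ← hJ] at h1
    have : J x * ev2 (d1 ω) T Uv x = 0 := by linear_combination h1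
    exact (mul_eq_zero.1 this).resolve_left (hJne x)
  have hlie : lie2 Z Ω = d1 ω := by
    funext x i j
    have e : i3 Z (d2 Ω) x i j = 0 := by
      have e3 : ∀ a, ω x a = ∑ i, Z x i * Ω x i a := fun a => (congrFun (hZ x) a).symm
      have e4 : ∑ a, Z x a * ω x a = 0 := ωZ x
      have e5 : ∀ a, d2 Ω x a i j = ω x a * Ω x i j - ω x i * Ω x a j + ω x j * Ω x a i :=
        fun a => (congrFun (congrFun (congrFun (hω x) a) i) j).symm
      have e6 := e3 i
      have e7 := e3 j
      unfold i3
      simp only [e5]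
      simp only [Fin.sum_univ_four] at e4 e6 e7 ⊢
      linear_combination Ω x i j * e4 + ω x i * e7 - ω x j * e6
    unfold lie2
    rw [iZ, e, add_zero]
  have θV : ∀ x, i1 Vv θ x = dirDeriv Z J x := by
    intro x
    have hJf : J = ev2 Ω T Uv := funext fun y => by rw [evT, hJ]
    have := lie2_ev hΩa dZ dT dU dΩ x
    rw [← hJf, ← hU, ← hV, hself, hlie, dωTU, evT] at this
    linarith
  have bT' : ∀ x i, T' x i = 1 * T x i - (dirDeriv Z J x / J x) * Z x i := fun x i => by
    rw [hT', one_mul]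
  have bV' : ∀ x i, V' x i = (1 / J x) * Vv x i - 0 * Z x i := fun x i => by
    rw [hV']; ring
  have bZ : ∀ x i, Z x i = 1 * Z x i - 0 * Z x i := fun x i => by ring
  have TZ : ∀ x, ev2 Ω T Z x = 0 := fun x => by rw [evT, θZ]
  have UZ : ∀ x, ev2 Ω Uv Z x = 0 := fun x => by rw [ev2_skew hΩa, evZ, ωU, neg_zero]
  refine ⟨fun x => ?_, fun x => ?_, fun x => ?_, fun x => ?_, fun x => ?_, fun x => ?_⟩
  · rw [ev2_lin Ω _ _ _ _ _ _ x _ _ _ _ (bZ x) (bT' x)]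
    simp only [evZ, ωT, ωZ]; ring
  · rw [ev2_lin Ω _ _ _ _ _ _ x _ _ _ _ (bZ x) (hU' x)]
    simp only [evZ, ωU, ωZ]; ring
  · rw [ev2_lin Ω _ _ _ _ _ _ x _ _ _ _ (bZ x) (bV' x)]
    simp only [evZ, ωV, ωZ]
    have := hJne x
    field_simp
    ring
  · rw [ev2_lin Ω _ _ _ _ _ _ x _ _ _ _ (bT' x) (hU' x)]
    simp only [TZ, evT, evZ, ωU, ωZ, ← hJ]
    have := hJne x
    field_simp
    ring
  · rw [ev2_lin Ω _ _ _ _ _ _ x _ _ _ _ (bT' x) (bV' x)]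
    simp only [TZ, evZ, evT, ωV, ωZ, θV]
    have := hJne x
    field_simp
    ring
  · rw [ev2_lin Ω _ _ _ _ _ _ x _ _ _ _ (hU' x) (bV' x)]
    simp only [UZ, evZ, ωV, ωZ]
    have := hJne x
    field_simp
    ring
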